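/- Fix η ∈ (0, 1/2). For any integers d ≥ 6, N ≥ 1, and any point a ∈ W, the proportion of pairs (v₁, v₂) ∈ 𝒯_{a,V²} satisfying all of: dist_d(a, v₁) ∈ [√B_{a,V} − 1/d^η, √B_{a,V} + 1/d^η], dist_d(a, v₂) ∈ [√B_{a,V} − 1/d^η, √B_{a,V} + 1/d^η], and dist_d(v₁, v₂) ∈ [1/√2 − 1/d^η, 1/√2 + 1/d^η], is at least 1 − 3/d^{1−2η}. -/

import Mathlib

/-- Euclidean distance between two points of `ℝ^d`. -/
noncomputable def dE {d : ℕ} (x y : Fin d → ℝ) : ℝ :=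
  Real.sqrt (∑ i, (x i - y i) ^ 2)

/-- Normalized distance `dist(x,y)/(√d · N)`. -/
noncomputable def dn (d N : ℕ) (x y : Fin d → ℝ) : ℝ :=
  dE x y / (Real.sqrt d * N)

/-- The lattice points `{0,1,…,N}^d` of the hypercube `[0,N]^d`. -/
noncomputable def cubeW (d N : ℕ) : Finset (Fin d → ℝ) :=
  Finset.image (fun f : Fin d → Fin (N + 1) => fun i => (f i : ℝ)) Finset.univ

/-- The `2^d` vertices `{0,N}^d` of the hypercube `[0,N]^d`. -/
noncomputable def cubeV (d N : ℕ) : Finset (Fin d → ℝ) :=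
  Finset.image (fun f : Fin d → Bool => fun i => if f i then (N : ℝ) else 0) Finset.univ

/-- The center `(N/2, …, N/2)` of the hypercube `[0,N]^d`. -/
noncomputable def ctr (d N : ℕ) : Fin d → ℝ := fun _ => (N : ℝ) / 2

/-- Average of squared Euclidean distances from `a` to the vertices. -/
noncomputable def A_V (d N : ℕ) (a : Fin d → ℝ) : ℝ :=
  (∑ v ∈ cubeV d N, dE v a ^ 2) / 2 ^ d

/-- Normalized average of squared distances from `a` to the vertices. -/
noncomputable def B_V (d N : ℕ) (a : Fin d → ℝ) : ℝ :=
  A_V d N a / (d * (N : ℝ) ^ 2)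

/-- Average of squared Euclidean distances from `a` to the lattice points. -/
noncomputable def A_W (d N : ℕ) (a : Fin d → ℝ) : ℝ :=
  (∑ w ∈ cubeW d N, dE w a ^ 2) / ((N : ℝ) + 1) ^ d

/-- Normalized average of squared distances from `a` to the lattice points. -/
noncomputable def B_W (d N : ℕ) (a : Fin d → ℝ) : ℝ :=
  A_W d N a / (d * (N : ℝ) ^ 2)

open Classical in
/-- Number of elements of a finite set satisfying a predicate. -/
noncomputable def pcount {α : Type*} (s : Finset α) (p : α → Prop) : ℕ :=
  (s.filter p).card

open Classical in
/-- Ordered pairs of vertices forming a non-degenerate triangle with `a`. -/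
noncomputable def TaV (d N : ℕ) (a : Fin d → ℝ) : Finset ((Fin d → ℝ) × (Fin d → ℝ)) :=
  ((cubeV d N) ×ˢ (cubeV d N)).filter (fun p => a ≠ p.1 ∧ a ≠ p.2 ∧ p.1 ≠ p.2)

open Classical in
/-- Ordered pairs of lattice points forming a non-degenerate triangle with `a`. -/
noncomputable def TaW (d N : ℕ) (a : Fin d → ℝ) : Finset ((Fin d → ℝ) × (Fin d → ℝ)) :=
  ((cubeW d N) ×ˢ (cubeW d N)).filter (fun p => a ≠ p.1 ∧ a ≠ p.2 ∧ p.1 ≠ p.2)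

/-- Cosine of the angle at `c` in the triangle `(a, c, v)`. -/
noncomputable def cosAngleAt {d : ℕ} (c a v : Fin d → ℝ) : ℝ :=
  (∑ i, (a i - c i) * (v i - c i)) / (dE a c * dE v c)

/-- The `±1` sign of a Boolean. -/
def boolSign (b : Bool) : ℝ := if b then 1 else -1

/-- The vertex of `{0, N}^d` encoded by a Boolean vector. -/
def vertex (d N : ℕ) (f : Fin d → Bool) : Fin d → ℝ := fun i => if f i then (N : ℝ) else 0

theorem sum_fin_succ_bool {d : ℕ} (F : (Fin (d + 1) → Bool) → ℝ) :
    ∑ f, F f =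
      ∑ f : Fin d → Bool, F (Fin.cons true f) + ∑ f : Fin d → Bool, F (Fin.cons false f) := by
  rw [← (Fin.consEquiv (fun _ : Fin (d + 1) => Bool)).sum_comp, Fintype.sum_prod_type,
    Fintype.sum_bool]
  rfl

theorem sum_rademacher (d : ℕ) (c : Fin d → ℝ) (x : ℝ) :
    ∑ f : Fin d → Bool, (x + ∑ i, c i * boolSign (f i)) = 2 ^ d * x := by
  induction d generalizing x with
  | zero => simp
  | succ d ih =>
    rw [sum_fin_succ_bool]
    simp only [Fin.sum_univ_succ, Fin.cons_zero, Fin.cons_succ, ← add_assoc, ih]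
    simp only [boolSign]
    norm_num
    ring

theorem sum_rademacher_sq (d : ℕ) (c : Fin d → ℝ) (x : ℝ) :
    ∑ f : Fin d → Bool, (x + ∑ i, c i * boolSign (f i)) ^ 2 = 2 ^ d * (x ^ 2 + ∑ i, c i ^ 2) := by
  induction d generalizing x with
  | zero => simp
  | succ d ih =>
    rw [sum_fin_succ_bool]
    simp only [Fin.sum_univ_succ, Fin.cons_zero, Fin.cons_succ, ← add_assoc, ih]
    simp only [boolSign]
    norm_num
    ring

theorem vertex_injective (d N : ℕ) (hN : 1 ≤ N) : Function.Injective (vertex d N) := by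
  intro f g h
  funext i
  have h1 := congrFun h i
  have hN0 : (N : ℝ) ≠ 0 := by positivity
  simp only [vertex] at h1
  cases hf : f i <;> cases hg : g i <;> simp_all

theorem sum_cubeV (d N : ℕ) (hN : 1 ≤ N) (F : (Fin d → ℝ) → ℝ) :
    ∑ v ∈ cubeV d N, F v = ∑ f, F (vertex d N f) :=
  Finset.sum_image (fun _ _ _ _ h => vertex_injective d N hN h)

theorem card_cubeV (d N : ℕ) (hN : 1 ≤ N) : (cubeV d N).card = 2 ^ d := by
  have : (cubeV d N).card = (Finset.univ : Finset (Fin d → Bool)).card :=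
    Finset.card_image_of_injective _ (vertex_injective d N hN)
  simp [this]

theorem dE_vertex_sq (d N : ℕ) (hN : 1 ≤ N) (a : Fin d → ℝ) (f : Fin d → Bool) :
    dE (vertex d N f) a ^ 2 =
      (N : ℝ) ^ 2 * ∑ i, ((a i / N - 1 / 2) ^ 2 + 1 / 4) +
        ∑ i, (-(N : ℝ) ^ 2 * (a i / N - 1 / 2)) * boolSign (f i) := by
  have hN0 : (N : ℝ) ≠ 0 := by positivity
  rw [dE, Real.sq_sqrt (Finset.sum_nonneg fun i _ => sq_nonneg _), Finset.mul_sum,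
    ← Finset.sum_add_distrib]
  refine Finset.sum_congr rfl fun i _ => ?_
  cases h : f i <;> simp [vertex, boolSign, h] <;> field_simp <;> ring

theorem B_V_eq (d N : ℕ) (hN : 1 ≤ N) (a : Fin d → ℝ) :
    B_V d N a = (∑ i, ((a i / N - 1 / 2) ^ 2 + 1 / 4)) / d := by
  have hN0 : (N : ℝ) ≠ 0 := by positivity
  rw [B_V, A_V, sum_cubeV d N hN]
  simp only [dE_vertex_sq d N hN]
  rw [sum_rademacher, mul_div_cancel_left₀ _ (by positivity), mul_comm (d : ℝ),
    mul_div_mul_left _ _ (by positivity)]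

theorem B_V_vertex (d N : ℕ) (hd : 1 ≤ d) (hN : 1 ≤ N) (f : Fin d → Bool) :
    B_V d N (vertex d N f) = 1 / 2 := by
  have hN0 : (N : ℝ) ≠ 0 := by positivity
  have hd0 : (d : ℝ) ≠ 0 := by positivity
  have h : ∀ i, (vertex d N f i / N - 1 / 2) ^ 2 + 1 / 4 = (1 / 2 : ℝ) := by
    intro i
    cases hf : f i <;> simp [vertex, hf, hN0] <;> norm_num
  rw [B_V_eq d N hN]
  simp only [h]
  simp
  field_simp

theorem dE_comm {d : ℕ} (x y : Fin d → ℝ) : dE x y = dE y x := by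
  simp only [dE, sub_sq_comm]

theorem dn_vertex_sq (d N : ℕ) (hN : 1 ≤ N) (a : Fin d → ℝ) (f : Fin d → Bool) :
    dn d N a (vertex d N f) ^ 2 - B_V d N a =
      0 + ∑ i, (-(a i / N - 1 / 2) / d) * boolSign (f i) := by
  have hN0 : (N : ℝ) ≠ 0 := by positivity
  rw [dn, dE_comm, div_pow, dE_vertex_sq d N hN, B_V_eq d N hN, mul_pow,
    Real.sq_sqrt (Nat.cast_nonneg d), add_div, mul_comm (d : ℝ),
    mul_div_mul_left _ _ (by positivity), add_sub_cancel_left, zero_add, Finset.sum_div]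
  refine Finset.sum_congr rfl fun i _ => ?_
  rw [neg_mul, neg_mul, mul_assoc, neg_div, mul_div_mul_left _ _ (by positivity)]
  ring

theorem mul_sq_le_sq_sub_sq_of_notMem_Icc {u B δ : ℝ} (hu : 0 ≤ u) (hδ : 0 ≤ δ) (hB : 0 ≤ B)
    (h : u ∉ Set.Icc (Real.sqrt B - δ) (Real.sqrt B + δ)) : B * δ ^ 2 ≤ (u ^ 2 - B) ^ 2 := by
  have hs := Real.sqrt_nonneg B
  have hsq := Real.sq_sqrt hB
  have h1 : δ ^ 2 ≤ (u - √B) ^ 2 := by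
    rw [sq_le_sq, abs_of_nonneg hδ]
    by_contra! hlt
    rw [abs_lt] at hlt
    exact h ⟨by linarith, by linarith⟩
  have h2 : B ≤ (u + √B) ^ 2 := by nlinarith [mul_nonneg hu hs]
  have h3 : (u ^ 2 - B) ^ 2 = (u + √B) ^ 2 * (u - √B) ^ 2 := by
    rw [← mul_pow, ← hsq, Real.sqrt_sq hs]
    ring
  rw [h3]
  exact mul_le_mul h2 h1 (sq_nonneg _) (sq_nonneg _)

theorem pcount_mul_le_sum {α : Type*} {s : Finset α} {p : α → Prop} {F : α → ℝ} {c : ℝ}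
    (h0 : ∀ x ∈ s, 0 ≤ F x) (h : ∀ x ∈ s, p x → c ≤ F x) : pcount s p * c ≤ ∑ x ∈ s, F x := by
  classical
  rw [pcount, ← nsmul_eq_mul]
  refine (Finset.card_nsmul_le_sum _ F _ fun x hx => ?_).trans
    (Finset.sum_le_sum_of_subset_of_nonneg (Finset.filter_subset _ _) fun x hx _ => h0 x hx)
  exact h x (Finset.mem_filter.1 hx).1 (Finset.mem_filter.1 hx).2

/-- Chebyshev's inequality for the normalized distance from `a` to a uniform random vertex. -/
theorem pcount_dn_notMem_le (d N : ℕ) (hd : 1 ≤ d) (hN : 1 ≤ N) (a : Fin d → ℝ)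
    (ha : ∀ i, a i ∈ Set.Icc (0 : ℝ) N) (δ : ℝ) (hδ : 0 ≤ δ) :
    (pcount (cubeV d N) (fun v => dn d N a v ∉
      Set.Icc (Real.sqrt (B_V d N a) - δ) (Real.sqrt (B_V d N a) + δ)) : ℝ) * (2 * (d * δ ^ 2))
      ≤ 2 ^ d := by
  have hN0 : (0 : ℝ) < N := by positivity
  have hd0 : (0 : ℝ) < d := by positivity
  set B := B_V d N a with hBdef
  set S : ℝ := ∑ i, (a i / N - 1 / 2) ^ 2 with hS
  have hBS : B * d = S + d / 4 := by
    rw [hBdef, B_V_eq d N hN, div_mul_cancel₀ _ hd0.ne', Finset.sum_add_distrib]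
    simp [hS]
    ring
  have hS0 : 0 ≤ S := Finset.sum_nonneg fun i _ => sq_nonneg _
  have hS1 : S ≤ d / 4 := by
    calc S ≤ ∑ i : Fin d, (1 / 4 : ℝ) := by
          refine Finset.sum_le_sum fun i _ => ?_
          have h0 : 0 ≤ a i / N := div_nonneg (ha i).1 hN0.le
          have h1 : a i / N ≤ 1 := (div_le_one hN0).2 (ha i).2
          nlinarith
      _ = d / 4 := by simp; ring
  have hB : 0 < B := by
    by_contra! hneg
    nlinarith
  have hvar : ∑ v ∈ cubeV d N, (dn d N a v ^ 2 - B) ^ 2 = 2 ^ d * (S / d ^ 2) := by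
    rw [sum_cubeV d N hN]
    simp only [hBdef, dn_vertex_sq d N hN, sum_rademacher_sq]
    simp [hS, div_pow, Finset.sum_div, sub_sq_comm]
  have hcheb : (pcount (cubeV d N) (fun v => dn d N a v ∉
      Set.Icc (Real.sqrt B - δ) (Real.sqrt B + δ)) : ℝ) * (B * δ ^ 2) ≤ 2 ^ d * (S / d ^ 2) := by
    rw [← hvar]
    refine pcount_mul_le_sum (fun v _ => sq_nonneg _) fun v _ hv => ?_
    exact mul_sq_le_sq_sub_sq_of_notMem_Icc (div_nonneg (Real.sqrt_nonneg _) (by positivity)) hδ hB.le hv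
  refine le_of_mul_le_mul_right ?_ hB
  calc _ = (pcount (cubeV d N) (fun v => dn d N a v ∉
          Set.Icc (Real.sqrt B - δ) (Real.sqrt B + δ)) : ℝ) * (B * δ ^ 2) * (2 * d) := by ring
    _ ≤ 2 ^ d * (S / d ^ 2) * (2 * d) := by gcongr
    _ = 2 ^ d * (2 * S / d) := by field_simp
    _ ≤ 2 ^ d * B := by
        gcongr
        rw [div_le_iff₀ hd0]
        linarith

theorem card_TaV_ge (d N : ℕ) (hN : 1 ≤ N) (a : Fin d → ℝ) :
    2 ^ d * 2 ^ d ≤ (TaV d N a).card + 3 * 2 ^ d := by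
  classical
  set V := cubeV d N
  have hV : V.card = 2 ^ d := card_cubeV d N hN
  have hsub : V ×ˢ V ⊆ TaV d N a ∪ ({a} ×ˢ V ∪ V ×ˢ {a} ∪ V.diag) := by
    rintro ⟨v, w⟩ h
    simp only [TaV, Finset.mem_union, Finset.mem_filter, Finset.mem_product, Finset.mem_singleton,
      Finset.mem_diag] at h ⊢
    grind
  have h := (Finset.card_le_card hsub).trans (Finset.card_union_le _ _)
  have h1 := Finset.card_union_le ({a} ×ˢ V ∪ V ×ˢ {a}) V.diag
  have h2 := Finset.card_union_le ({a} ×ˢ V) (V ×ˢ {a})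
  simp only [Finset.card_product, Finset.card_singleton, Finset.diag_card, hV] at h h1 h2
  lia

/-- Union bound for three events on pairs. -/
theorem pcount_product_not_le {α : Type*} (V : Finset α) (T : Finset (α × α)) (hT : T ⊆ V ×ˢ V)
    (p : α → Prop) (q : α → α → Prop) :
    pcount T (fun x => ¬ (p x.1 ∧ p x.2 ∧ q x.1 x.2)) ≤
      pcount V (fun v => ¬ p v) * V.card + V.card * pcount V (fun v => ¬ p v) +
        ∑ v ∈ V, pcount V (fun w => ¬ q v w) := by
  classical
  have hsub : T.filter (fun x => ¬ (p x.1 ∧ p x.2 ∧ q x.1 x.2)) ⊆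
      (V.filter (fun v => ¬ p v)) ×ˢ V ∪ V ×ˢ (V.filter (fun v => ¬ p v)) ∪
        (V ×ˢ V).filter (fun x => ¬ q x.1 x.2) := by
    rintro ⟨v, w⟩ h
    have hVW := hT (Finset.mem_filter.1 h).1
    simp only [Finset.mem_union, Finset.mem_filter, Finset.mem_product] at h hVW ⊢
    tauto
  have hq : ((V ×ˢ V).filter (fun x => ¬ q x.1 x.2)).card =
      ∑ v ∈ V, pcount V (fun w => ¬ q v w) := by
    simp only [pcount, Finset.card_filter, Finset.sum_product]
    refine Finset.sum_congr rfl fun v _ => Finset.sum_congr rfl fun w _ => ?_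
    congr
  have h := Finset.card_le_card hsub
  have h1 := Finset.card_union_le
    ((V.filter (fun v => ¬ p v)) ×ˢ V ∪ V ×ˢ (V.filter (fun v => ¬ p v)))
    ((V ×ˢ V).filter (fun x => ¬ q x.1 x.2))
  have h2 := Finset.card_union_le ((V.filter (fun v => ¬ p v)) ×ˢ V)
    (V ×ˢ (V.filter (fun v => ¬ p v)))
  simp only [Finset.card_product] at h2
  rw [hq] at h1
  have e1 : pcount T (fun x => ¬ (p x.1 ∧ p x.2 ∧ q x.1 x.2)) =
      (T.filter (fun x => ¬ (p x.1 ∧ p x.2 ∧ q x.1 x.2))).card := by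
    unfold pcount; congr
  have e2 : pcount V (fun v => ¬ p v) = (V.filter (fun v => ¬ p v)).card := by
    unfold pcount; congr
  rw [e1, e2]
  lia

theorem pcount_add_pcount_not {α : Type*} (s : Finset α) (p : α → Prop) :
    pcount s p + pcount s (fun x => ¬ p x) = s.card := by
  classical
  rw [← Finset.card_filter_add_card_filter_not (s := s) p]
  unfold pcount
  congr

theorem stmt7 (η : ℝ) (hη : η ∈ Set.Ioo (0 : ℝ) (1 / 2)) (d N : ℕ) (hd : 6 ≤ d) (hN : 1 ≤ N)
    (a : Fin d → ℝ) (ha : a ∈ cubeW d N) :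
    (1 : ℝ) - 3 / (d : ℝ) ^ ((1 : ℝ) - 2 * η) ≤
      (pcount (TaV d N a)
          (fun p =>
            dn d N a p.1 ∈ Set.Icc (Real.sqrt (B_V d N a) - 1 / (d : ℝ) ^ η)
              (Real.sqrt (B_V d N a) + 1 / (d : ℝ) ^ η) ∧
            dn d N a p.2 ∈ Set.Icc (Real.sqrt (B_V d N a) - 1 / (d : ℝ) ^ η)
              (Real.sqrt (B_V d N a) + 1 / (d : ℝ) ^ η) ∧
            dn d N p.1 p.2 ∈ Set.Icc (1 / Real.sqrt 2 - 1 / (d : ℝ) ^ η)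
              (1 / Real.sqrt 2 + 1 / (d : ℝ) ^ η)) : ℝ) /
        (TaV d N a).card := by
  have hd1 : 1 ≤ d := by lia
  have hd0 : (0 : ℝ) < d := by positivity
  set δ : ℝ := 1 / (d : ℝ) ^ η with hδ
  set D : ℝ := (d : ℝ) ^ ((1 : ℝ) - 2 * η) with hD
  have hD0 : 0 < D := Real.rpow_pos_of_pos hd0 _
  have hδ0 : 0 ≤ δ := by positivity
  have hdδ : d * δ ^ 2 = D := by
    rw [hδ, hD, Real.rpow_sub hd0, Real.rpow_one, mul_comm 2 η, Real.rpow_mul hd0.le,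
      Real.rpow_two, div_pow, one_pow, mul_one_div]
  have haW : ∀ i, a i ∈ Set.Icc (0 : ℝ) N := by
    obtain ⟨f, -, rfl⟩ := Finset.mem_image.1 ha
    intro i
    exact ⟨Nat.cast_nonneg _, Nat.cast_le.2 (Nat.lt_succ_iff.1 (f i).2)⟩
  have hTV : TaV d N a ⊆ cubeV d N ×ˢ cubeV d N := Finset.filter_subset _ _
  have hbad := pcount_product_not_le (cubeV d N) (TaV d N a) hTV
    (fun v => dn d N a v ∈ Set.Icc (Real.sqrt (B_V d N a) - δ) (Real.sqrt (B_V d N a) + δ))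
    (fun v w => dn d N v w ∈ Set.Icc (1 / Real.sqrt 2 - δ) (1 / Real.sqrt 2 + δ))
  have hadd := pcount_add_pcount_not (TaV d N a) (fun p =>
    dn d N a p.1 ∈ Set.Icc (Real.sqrt (B_V d N a) - δ) (Real.sqrt (B_V d N a) + δ) ∧
    dn d N a p.2 ∈ Set.Icc (Real.sqrt (B_V d N a) - δ) (Real.sqrt (B_V d N a) + δ) ∧
    dn d N p.1 p.2 ∈ Set.Icc (1 / Real.sqrt 2 - δ) (1 / Real.sqrt 2 + δ))
  have hp := pcount_dn_notMem_le d N hd1 hN a haW δ hδ0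
  have hq : ∀ v ∈ cubeV d N, (pcount (cubeV d N) (fun w => dn d N v w ∉
      Set.Icc (1 / Real.sqrt 2 - δ) (1 / Real.sqrt 2 + δ)) : ℝ) ≤ 2 ^ d / (2 * D) := by
    intro v hv
    obtain ⟨f, -, rfl⟩ := Finset.mem_image.1 hv
    have h := pcount_dn_notMem_le d N hd1 hN (vertex d N f)
      (fun i => by unfold vertex; split_ifs <;> simp) δ hδ0
    rw [B_V_vertex d N hd1 hN, Real.sqrt_div zero_le_one, Real.sqrt_one, hdδ] at h
    rw [le_div_iff₀ (by positivity)]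
    exact h
  rw [hdδ, ← le_div_iff₀ (by positivity)] at hp
  have hsum := Finset.sum_le_sum hq
  rw [Finset.sum_const, card_cubeV d N hN, nsmul_eq_mul] at hsum
  rw [card_cubeV d N hN] at hbad
  have hT := card_TaV_ge d N hN a
  have h64 : 2 ^ 6 ≤ 2 ^ d := Nat.pow_le_pow_right (by norm_num) hd
  have hT2 : (2 ^ d * 2 ^ d : ℝ) ≤ 2 * (TaV d N a).card := by
    have : 2 ^ d * 2 ^ d ≤ 2 * (TaV d N a).card := by nlinarith
    exact_mod_cast this
  have hT0 : (0 : ℝ) < (TaV d N a).card := by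
    have : (0 : ℝ) < 2 ^ d * 2 ^ d := by positivity
    linarith
  rw [le_div_iff₀ hT0]
  rify at hbad hadd hsum
  have hbad' := hbad.trans (b := _) (c := 2 ^ d * 2 ^ d * (3 / (2 * D))) (by
    have e : (2 ^ d * 2 ^ d * (3 / (2 * D)) : ℝ) = 2 ^ d / (2 * D) * 2 ^ d +
      2 ^ d * (2 ^ d / (2 * D)) + 2 ^ d * (2 ^ d / (2 * D)) := by ring
    rw [e]
    gcongr)
  have hfin : (2 ^ d * 2 ^ d * (3 / (2 * D)) : ℝ) ≤ 2 * (TaV d N a).card * (3 / (2 * D)) := by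
    gcongr
  have e : (2 * (TaV d N a).card * (3 / (2 * D)) : ℝ) = 3 / D * (TaV d N a).card := by
    field_simp
  linarith
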